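/- For every permutation w ∈ S_n and every k with 1 ≤ k ≤ n-1, the value n is a k-peak of w. -/

import Mathlib

open Nat

/-- `ι` enumerates (the positions of) an alternating subsequence of `w`:
positions are strictly increasing and the values satisfy `w_{i₁} > w_{i₂} < w_{i₃} > ⋯`. -/
def IsAltSeq {n : ℕ} (w : Equiv.Perm (Fin n)) {s : ℕ} (ι : Fin s → Fin n) : Prop :=
  StrictMono ι ∧
    ∀ (j : ℕ) (hj : j + 1 < s),
      if j % 2 = 0 then
        (w (ι ⟨j + 1, hj⟩) : ℕ) < (w (ι ⟨j, Nat.lt_of_succ_lt hj⟩) : ℕ)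
      else
        (w (ι ⟨j, Nat.lt_of_succ_lt hj⟩) : ℕ) < (w (ι ⟨j + 1, hj⟩) : ℕ)

/-- `ι` enumerates a reverse alternating subsequence of `w`:
`w_{i₁} < w_{i₂} > w_{i₃} < ⋯`. -/
def IsRevAltSeq {n : ℕ} (w : Equiv.Perm (Fin n)) {s : ℕ} (ι : Fin s → Fin n) : Prop :=
  StrictMono ι ∧
    ∀ (j : ℕ) (hj : j + 1 < s),
      if j % 2 = 0 then
        (w (ι ⟨j, Nat.lt_of_succ_lt hj⟩) : ℕ) < (w (ι ⟨j + 1, hj⟩) : ℕ)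
      else
        (w (ι ⟨j + 1, hj⟩) : ℕ) < (w (ι ⟨j, Nat.lt_of_succ_lt hj⟩) : ℕ)

/-- Each pair of neighbouring entries of the subsequence differs by at least `k`
in absolute value. -/
def HasGaps (k : ℕ) {n : ℕ} (w : Equiv.Perm (Fin n)) {s : ℕ} (ι : Fin s → Fin n) : Prop :=
  ∀ (j : ℕ) (hj : j + 1 < s),
    (k : ℤ) ≤ |((w (ι ⟨j, Nat.lt_of_succ_lt hj⟩) : ℕ) : ℤ) -
               ((w (ι ⟨j + 1, hj⟩) : ℕ) : ℤ)|

/-- `as_k(w)`: the maximal length of a `k`-alternating subsequence of `w`. -/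
noncomputable def kAltLen (n k : ℕ) (w : Equiv.Perm (Fin n)) : ℕ :=
  sSup {s : ℕ | ∃ ι : Fin s → Fin n, IsAltSeq w ι ∧ HasGaps k w ι}

/-- The maximal length of a `k`-reverse-alternating subsequence of `w`. -/
noncomputable def kRevAltLen (n k : ℕ) (w : Equiv.Perm (Fin n)) : ℕ :=
  sSup {s : ℕ | ∃ ι : Fin s → Fin n, IsRevAltSeq w ι ∧ HasGaps k w ι}

/-- `zs_k(w)`: the maximal length of a `k`-zigzagging subsequence of `w`. -/
noncomputable def kZigLen (n k : ℕ) (w : Equiv.Perm (Fin n)) : ℕ :=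
  sSup {s : ℕ | ∃ ι : Fin s → Fin n, (IsAltSeq w ι ∨ IsRevAltSeq w ι) ∧ HasGaps k w ι}

/-- The section `w_s ⋯ w_t` is a `k`-up: `s < t` and `w_t - w_s ≥ k`. -/
def IsKUp (k : ℕ) {n : ℕ} (w : Equiv.Perm (Fin n)) (s t : Fin n) : Prop :=
  s < t ∧ (w s : ℕ) + k ≤ (w t : ℕ)

/-- The section `w_s ⋯ w_t` is a `k`-down: `s < t` and `w_s - w_t ≥ k`. -/
def IsKDown (k : ℕ) {n : ℕ} (w : Equiv.Perm (Fin n)) (s t : Fin n) : Prop :=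
  s < t ∧ (w t : ℕ) + k ≤ (w s : ℕ)

/-- The section `w_i ⋯ w_j` is `k`-ascending: `w_i` is its minimum, `w_j` its maximum,
`w_j - w_i ≥ k`, and there is no `k`-down inside it. -/
def IsKAsc (k : ℕ) {n : ℕ} (w : Equiv.Perm (Fin n)) (i j : Fin n) : Prop :=
  i < j ∧
  (∀ t : Fin n, i ≤ t → t ≤ j → (w i : ℕ) ≤ (w t : ℕ) ∧ (w t : ℕ) ≤ (w j : ℕ)) ∧
  (w i : ℕ) + k ≤ (w j : ℕ) ∧
  ∀ s t : Fin n, i ≤ s → t ≤ j → ¬ IsKDown k w s t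

/-- The section `w_i ⋯ w_j` is `k`-descending: `w_i` is its maximum, `w_j` its minimum,
`w_i - w_j ≥ k`, and there is no `k`-up inside it. -/
def IsKDesc (k : ℕ) {n : ℕ} (w : Equiv.Perm (Fin n)) (i j : Fin n) : Prop :=
  i < j ∧
  (∀ t : Fin n, i ≤ t → t ≤ j → (w t : ℕ) ≤ (w i : ℕ) ∧ (w j : ℕ) ≤ (w t : ℕ)) ∧
  (w j : ℕ) + k ≤ (w i : ℕ) ∧
  ∀ s t : Fin n, i ≤ s → t ≤ j → ¬ IsKUp k w s t

/-- `w_i ⋯ w_j` is a maximal `k`-ascending section: it is `k`-ascending and it is not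
contained in any other `k`-ascending section. -/
def IsMaxKAsc (k : ℕ) {n : ℕ} (w : Equiv.Perm (Fin n)) (i j : Fin n) : Prop :=
  IsKAsc k w i j ∧ ∀ i' j' : Fin n, IsKAsc k w i' j' → i' ≤ i → j ≤ j' → i' = i ∧ j' = j

/-- `w_i ⋯ w_j` is a maximal `k`-descending section. -/
def IsMaxKDesc (k : ℕ) {n : ℕ} (w : Equiv.Perm (Fin n)) (i j : Fin n) : Prop :=
  IsKDesc k w i j ∧ ∀ i' j' : Fin n, IsKDesc k w i' j' → i' ≤ i → j ≤ j' → i' = i ∧ j' = j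

/-- `w_p` is a `k`-peak of `w`: `p` is the right end of a maximal `k`-ascending section
or the left end of a maximal `k`-descending section. -/
def IsKPeakPos (k : ℕ) {n : ℕ} (w : Equiv.Perm (Fin n)) (p : Fin n) : Prop :=
  (∃ i, IsMaxKAsc k w i p) ∨ (∃ j, IsMaxKDesc k w p j)

/-- `w_p` is a `k`-valley of `w`: `p` is the left end of a maximal `k`-ascending section
or the right end of a maximal `k`-descending section. -/
def IsKValleyPos (k : ℕ) {n : ℕ} (w : Equiv.Perm (Fin n)) (p : Fin n) : Prop :=
  (∃ j, IsMaxKAsc k w p j) ∨ (∃ i, IsMaxKDesc k w i p)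

/-- A section starting at the last entry which lies at least `k` below a later maximum of `w`
and ending at that maximum is `k`-ascending. -/
theorem exists_isKAsc_of_forall_le {n k : ℕ} (w : Equiv.Perm (Fin n)) (p : Fin n)
    (hmax : ∀ t, (w t : ℕ) ≤ (w p : ℕ)) (hup : ∃ q, IsKUp k w q p) :
    ∃ i, IsKAsc k w i p := by
  obtain ⟨i, ⟨hip, hik⟩, hi⟩ := Set.Finite.exists_maximal (Set.toFinite {q | IsKUp k w q p}) hup
  have hgap : ∀ t, i < t → t ≤ p → (w p : ℕ) < w t + k ∨ t = p := by
    intro t hit htp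
    by_contra! h
    exact absurd (hi (show IsKUp k w t p from ⟨lt_of_le_of_ne htp h.2, h.1⟩) hit.le)
      (not_le.mpr hit)
  have hmin : ∀ t, i ≤ t → t ≤ p → (w i : ℕ) ≤ w t := by
    intro t hit htp
    rcases hit.eq_or_lt with rfl | hlt
    · exact le_rfl
    · rcases hgap t hlt htp with h | rfl <;> omega
  refine ⟨i, hip, fun t hit htp => ⟨hmin t hit htp, hmax t⟩, hik, ?_⟩
  rintro s t his htp ⟨hst, hd⟩
  have hs := hmax s
  have hit := his.trans_lt hst
  rcases hgap t hit htp with h | rfl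
  · omega
  · have hk : k = 0 := by omega
    have hws : w s = w t := Fin.ext (by omega)
    exact hst.ne (w.injective hws)

/-- A maximum of `w` that ends a `k`-up ends a maximal `k`-ascending section. -/
theorem exists_isMaxKAsc_of_forall_le {n k : ℕ} (w : Equiv.Perm (Fin n)) (p : Fin n)
    (hmax : ∀ t, (w t : ℕ) ≤ (w p : ℕ)) (hup : ∃ q, IsKUp k w q p) :
    ∃ i, IsMaxKAsc k w i p := by
  obtain ⟨i, hi, hmin⟩ := Set.Finite.exists_minimal (Set.toFinite {i | IsKAsc k w i p})
    (exists_isKAsc_of_forall_le w p hmax hup)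
  refine ⟨i, hi, fun i' j' h hii hpj => ?_⟩
  have hle : (w p : ℕ) ≤ w j' := (h.2.1 p (hii.trans hi.1.le) hpj).2
  obtain rfl : j' = p := w.injective (Fin.ext (le_antisymm (hmax j') hle))
  exact ⟨le_antisymm hii (hmin h hii), rfl⟩

/-- Reversing `w` turns `k`-ascending sections into `k`-descending ones. -/
theorem isKAsc_revPerm_trans {n k : ℕ} (w : Equiv.Perm (Fin n)) (i j : Fin n) :
    IsKAsc k (Fin.revPerm.trans w) i.rev j.rev ↔ IsKDesc k w j i := by
  simp only [IsKAsc, IsKDesc, IsKDown, IsKUp, Equiv.trans_apply, Fin.revPerm_apply,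
    Fin.rev_rev, Fin.rev_lt_rev]
  refine and_congr_right' (and_congr ?_ (and_congr_right' ?_))
  · constructor <;> intro h t h₁ h₂
    · simpa [and_comm] using h t.rev (Fin.rev_le_rev.mpr h₂) (Fin.rev_le_rev.mpr h₁)
    · simpa [and_comm] using h t.rev (Fin.le_rev_iff.mpr h₂) (Fin.rev_le_iff.mpr h₁)
  · constructor <;> intro h s t h₁ h₂
    · simpa using h t.rev s.rev (Fin.rev_le_rev.mpr h₂) (Fin.rev_le_rev.mpr h₁)
    · simpa using h t.rev s.rev (Fin.le_rev_iff.mpr h₂) (Fin.rev_le_iff.mpr h₁)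

/-- A maximum of `w` that starts a `k`-down starts a maximal `k`-descending section. -/
theorem exists_isMaxKDesc_of_forall_le {n k : ℕ} (w : Equiv.Perm (Fin n)) (p : Fin n)
    (hmax : ∀ t, (w t : ℕ) ≤ (w p : ℕ)) (hdown : ∃ q, IsKDown k w p q) :
    ∃ j, IsMaxKDesc k w p j := by
  obtain ⟨q, hpq, hq⟩ := hdown
  obtain ⟨i, hi, hmaxl⟩ := exists_isMaxKAsc_of_forall_le (k := k) (Fin.revPerm.trans w) p.rev
    (fun t => by simpa using hmax t.rev) ⟨q.rev, Fin.rev_lt_rev.mpr hpq, by simpa using hq⟩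
  obtain ⟨j, rfl⟩ := Fin.rev_surjective i
  refine ⟨j, (isKAsc_revPerm_trans w j p).mp hi, fun i' j' h h₁ h₂ => ?_⟩
  have := hmaxl j'.rev i'.rev ((isKAsc_revPerm_trans w j' i').mpr h)
    (Fin.rev_le_rev.mpr h₂) (Fin.rev_le_rev.mpr h₁)
  exact ⟨Fin.rev_injective this.2, Fin.rev_injective this.1⟩

/-- The value `n` (the position `p` with `w_p = n`) is a `k`-peak of every permutation. -/
theorem value_n_is_kPeak (n k : ℕ) (hn : 2 ≤ n) (hk : 1 ≤ k) (hkn : k ≤ n - 1)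
    (w : Equiv.Perm (Fin n)) (p : Fin n) (hp : (w p : ℕ) + 1 = n) :
    IsKPeakPos k w p := by
  have hmax : ∀ t, (w t : ℕ) ≤ (w p : ℕ) := fun t => by have := (w t).isLt; omega
  obtain ⟨q, hq⟩ := w.surjective ⟨0, by omega⟩
  have hq0 : (w q : ℕ) = 0 := by rw [hq]
  rcases lt_trichotomy q p with h | rfl | h
  · exact Or.inl (exists_isMaxKAsc_of_forall_le w p hmax ⟨q, h, by omega⟩)
  · omega
  · exact Or.inr (exists_isMaxKDesc_of_forall_le w p hmax ⟨q, h, by omega⟩)
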